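/- arXiv:math/0505529 — 2 statements merged into one kernel-verified Lean document; each statement's English description precedes it below -/
import Mathlib

section
/- Fix λ ∈ ℝ and ε > 0. Define b_k(μ) := k^{k−1} μ^{k−1} e^{-kμ} / k!, and define q(μ) := 0 for μ ≤ 1 and q(μ) := the unique solution in (0,1) of 1 − q = e^{-μq} for μ > 1. Then lim_{n→∞} n^{1/3} · ( q(1 + λ n^{-1/3}) + Σ_{k ≥ ε n^{2/3}} b_k(1 + λ n^{-1/3}) ) = 2·max(λ,0) + ∫_ε^∞ (2π)^{-1/2} x^{-3/2} e^{-λ² x / 2} dx. -/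
open Filter Real MeasureTheory

/-- The Borel(μ) probability mass function: the probability that a Galton–Watson
process with Poisson(μ) offspring has total progeny exactly `k`. -/
noncomputable def borelPMF (k : ℕ) (μ : ℝ) : ℝ :=
  (k : ℝ) ^ (k - 1) * μ ^ (k - 1) * Real.exp (-(k : ℝ) * μ) / (Nat.factorial k)

lemma aux_exp (x : ℝ) (hx : 0 ≤ x) : Real.exp (-x) ≤ 1 - x + x ^ 2 / 2 := by
  have h := Real.quadratic_le_exp_of_nonneg hx
  have h1 : 0 < 1 - x + x ^ 2 / 2 := by nlinarith [sq_nonneg (x - 1)]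
  have h2 : Real.exp (-x) * Real.exp x = 1 := by rw [← Real.exp_add]; simp
  have h3 : 1 ≤ (1 - x + x ^ 2 / 2) * Real.exp x := by
    calc (1:ℝ) ≤ (1 - x + x ^ 2 / 2) * (1 + x + x ^ 2 / 2) := by nlinarith [sq_nonneg (x ^ 2)]
      _ ≤ _ := by gcongr
  exact le_of_mul_le_mul_right (h2.le.trans h3) (Real.exp_pos x)

lemma q_bounds (μ q : ℝ) (hμ : 1 < μ) (h0 : 0 < q) (h1 : q < 1)
    (h : 1 - q = Real.exp (-μ * q)) :
    2 * (μ - 1) / μ ^ 2 ≤ q ∧ q ≤ 2 * (μ - 1) := by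
  constructor
  · have := aux_exp (μ * q) (by positivity)
    rw [← neg_mul, ← h] at this
    rw [div_le_iff₀ (by positivity)]
    have h3 : q * (2 * (μ - 1)) ≤ q * (q * μ ^ 2) := by nlinarith
    exact le_of_mul_le_mul_left h3 h0
  · have hs := Real.hasSum_pow_div_log_of_abs_lt_one (x := q) (by rw [abs_of_pos h0]; exact h1)
    have h2 := sum_le_hasSum (Finset.range 2) (fun i _ => by positivity) hs
    rw [h, Real.log_exp] at h2
    simp [Finset.sum_range_succ] at h2
    have h3 : q * q ≤ q * (2 * (μ - 1)) := by nlinarith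
    exact le_of_mul_le_mul_left h3 h0

lemma q_lim (l : ℝ) (q : ℝ → ℝ)
    (hq0 : ∀ μ : ℝ, μ ≤ 1 → q μ = 0)
    (hq1 : ∀ μ : ℝ, 1 < μ → q μ ∈ Set.Ioo (0 : ℝ) 1 ∧ 1 - q μ = Real.exp (-μ * q μ)) :
    Tendsto (fun m : ℝ => m * q (1 + l * m⁻¹)) atTop (nhds (2 * max l 0)) := by
  rcases le_or_gt l 0 with hl | hl
  · rw [max_eq_right hl]
    refine tendsto_const_nhds.congr' ?_
    filter_upwards [eventually_gt_atTop 0] with m hm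
    rw [hq0]
    · simp
    · have : 0 < m⁻¹ := by positivity
      nlinarith
  · rw [max_eq_left hl.le]
    have hδ : Tendsto (fun m : ℝ => 1 + l * m⁻¹) atTop (nhds 1) := by
      simpa using (tendsto_inv_atTop_zero.const_mul l).const_add 1
    have hlow : Tendsto (fun m : ℝ => 2 * l / (1 + l * m⁻¹) ^ 2) atTop (nhds (2 * l)) := by
      have := (tendsto_const_nhds (x := 2 * l) (f := (atTop : Filter ℝ))).div (hδ.pow 2)
        (by norm_num)
      rw [one_pow, div_one] at this
      exact this
    refine tendsto_of_tendsto_of_tendsto_of_le_of_le' hlow tendsto_const_nhds ?_ ?_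
    all_goals
      filter_upwards [eventually_gt_atTop 0] with m hm
      have hp : 0 < l * m⁻¹ := by positivity
      obtain ⟨⟨ha, hb⟩, hc⟩ := hq1 (1 + l * m⁻¹) (by linarith)
      obtain ⟨hd, he⟩ := q_bounds _ _ (by linarith) ha hb hc
    · calc 2 * l / (1 + l * m⁻¹) ^ 2 = m * (2 * (1 + l * m⁻¹ - 1) / (1 + l * m⁻¹) ^ 2) := by
            rw [add_sub_cancel_left, ← mul_div_assoc]
            congr 1
            field_simp
        _ ≤ _ := by gcongr
    · calc _ ≤ m * (2 * (1 + l * m⁻¹ - 1)) := by gcongr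
        _ = 2 * l := by field_simp; ring

lemma map_floor (s : ℝ) (hs : 0 < s) :
    Measure.map (fun x : ℝ => ⌊x * s⌋₊) (volume.restrict (Set.Ici 0)) =
      ENNReal.ofReal (s⁻¹) • Measure.count := by
  have hm : Measurable (fun x : ℝ => ⌊x * s⌋₊) := by fun_prop
  refine Measure.ext_of_singleton fun k => ?_
  rw [Measure.map_apply hm (measurableSet_singleton k),
    Measure.restrict_apply (hm (measurableSet_singleton k))]
  have : ((fun x : ℝ => ⌊x * s⌋₊) ⁻¹' {k} ∩ Set.Ici 0) = Set.Ico (k / s) ((k + 1) / s) := by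
    ext x
    simp only [Set.mem_inter_iff, Set.mem_preimage, Set.mem_singleton_iff, Set.mem_Ici, Set.mem_Ico,
      div_le_iff₀ hs, lt_div_iff₀ hs]
    constructor
    · rintro ⟨h, h0⟩
      exact (Nat.floor_eq_iff (by positivity)).1 h
    · intro h
      have h0 : 0 ≤ x * s := le_trans (by positivity) h.1
      exact ⟨(Nat.floor_eq_iff h0).2 h, nonneg_of_mul_nonneg_left h0 hs⟩
  rw [this, Real.volume_Ico]
  simp
  congr 1
  field_simp
  ring

lemma count_tsum (f : ℕ → ℝ) : ∫ k, f k ∂Measure.count = ∑' k, f k := by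
  by_cases hf : Integrable f Measure.count
  · rw [integral_countable hf]
    simp [Measure.real]
  · rw [integral_undef hf, tsum_eq_zero_of_not_summable]
    intro h
    exact hf (integrable_count_iff.2 h.norm)

lemma tsum_eq_int (s : ℝ) (hs : 0 < s) (f : ℕ → ℝ) :
    ∑' k, f k = s * ∫ x in Set.Ici (0:ℝ), f ⌊x * s⌋₊ := by
  have h := integral_map (μ := volume.restrict (Set.Ici (0:ℝ))) (φ := fun x : ℝ => ⌊x * s⌋₊)
    (by fun_prop) (f := f) (Measurable.of_discrete.aestronglyMeasurable)
  rw [← h, map_floor s hs, integral_smul_measure, count_tsum, ENNReal.toReal_ofReal (by positivity)]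
  simp [hs.ne']

lemma borel_eq (k : ℕ) (hk : k ≠ 0) (μ : ℝ) (hμ : 0 < μ) :
    borelPMF k μ = μ⁻¹ * ((k:ℝ)⁻¹ * (√k)⁻¹) * ((√2)⁻¹ * (Stirling.stirlingSeq k)⁻¹) *
      Real.exp (k * (Real.log μ + 1 - μ)) := by
  obtain ⟨j, rfl⟩ := Nat.exists_eq_succ_of_ne_zero hk
  have hj : (0:ℝ) < (j.succ : ℕ) := by positivity
  have he : Real.exp (((j.succ : ℕ) : ℝ) * (Real.log μ + 1 - μ)) =
      μ ^ j.succ * Real.exp 1 ^ j.succ * Real.exp (-((j.succ : ℕ) : ℝ) * μ) := by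
    rw [← Real.exp_nat_mul 1, ← Real.exp_log hμ, ← Real.exp_nat_mul, ← Real.exp_add, ← Real.exp_add,
      Real.log_exp]
    congr 1
    ring
  rw [he]
  unfold borelPMF Stirling.stirlingSeq
  generalize hK : ((j.succ : ℕ) : ℝ) = K at *
  have h2 : √(2 * K) = √2 * √K := Real.sqrt_mul (by norm_num) _
  have hf : (0:ℝ) < (Nat.factorial j.succ) := by positivity
  have hs : √K * √K = K := Real.mul_self_sqrt hj.le
  have hsp : 0 < √K := Real.sqrt_pos.2 hj
  rw [h2, div_pow, Nat.succ_sub_one]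
  field_simp
  simp only [Nat.succ_eq_add_one, pow_succ]
  ring

lemma log_le (μ : ℝ) (hμ : 0 < μ) : Real.log μ + 1 - μ ≤ 0 := by
  linarith [Real.log_le_sub_one_of_pos hμ]

lemma borel_nonneg (k : ℕ) (μ : ℝ) (hμ : 0 < μ) : 0 ≤ borelPMF k μ := by
  unfold borelPMF; positivity

lemma borel_le (k : ℕ) (hk : k ≠ 0) (μ : ℝ) (hμ : 1/2 ≤ μ) :
    borelPMF k μ ≤ 2 * ((k:ℝ)⁻¹ * (√k)⁻¹) := by
  have hμ' : 0 < μ := by linarith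
  rw [borel_eq k hk μ hμ']
  have h1 : μ⁻¹ ≤ 2 := by
    rw [inv_le_comm₀ hμ' (by norm_num)]; linarith
  have h2 : (√2)⁻¹ ≤ 1 := inv_le_one_of_one_le₀ (by rw [Real.one_le_sqrt]; norm_num)
  have h30 : 1 ≤ Stirling.stirlingSeq k :=
    le_trans (by rw [Real.one_le_sqrt]; linarith [Real.pi_gt_three])
      (Stirling.sqrt_pi_le_stirlingSeq hk)
  have h3 : (Stirling.stirlingSeq k)⁻¹ ≤ 1 := inv_le_one_of_one_le₀ h30
  have h4 : Real.exp (k * (Real.log μ + 1 - μ)) ≤ 1 := by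
    rw [Real.exp_le_one_iff]
    exact mul_nonpos_of_nonneg_of_nonpos (by positivity) (log_le μ hμ')
  have h5 : 0 ≤ (Stirling.stirlingSeq k)⁻¹ := by positivity
  calc _ ≤ 2 * ((k:ℝ)⁻¹ * (√k)⁻¹) * (1 * 1) * 1 := by gcongr
    _ = _ := by ring

lemma log_lim (l : ℝ) : Tendsto (fun m : ℝ => m ^ 2 * (Real.log (1 + l * m⁻¹) + 1 - (1 + l * m⁻¹)))
    atTop (nhds (-(l ^ 2) / 2)) := by
  have hd : Tendsto (fun m : ℝ => l * m⁻¹) atTop (nhds 0) := by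
    simpa using (tendsto_inv_atTop_zero.const_mul l)
  have hb : Tendsto (fun m : ℝ => 2 * |l| ^ 3 * m⁻¹) atTop (nhds 0) := by
    have h := (tendsto_inv_atTop_zero (𝕜 := ℝ)).const_mul (2 * |l| ^ 3)
    rw [mul_zero] at h
    exact h
  rw [tendsto_iff_norm_sub_tendsto_zero]
  refine squeeze_zero' (Eventually.of_forall fun _ => norm_nonneg _) ?_ hb
  have hsm : ∀ᶠ m : ℝ in atTop, |l * m⁻¹| < 1/2 := by
    have := hd.abs
    rw [abs_zero] at this
    exact this.eventually_lt_const (by norm_num)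
  filter_upwards [hsm, eventually_gt_atTop 0] with m h1 hm
  have h := Real.abs_log_sub_add_sum_range_le (x := -(l * m⁻¹)) (by rw [abs_neg]; linarith) 2
  rw [abs_neg] at h
  simp only [Finset.sum_range_succ, Finset.sum_range_zero] at h
  have h2 : |l * m⁻¹| ^ (2 + 1) / (1 - |l * m⁻¹|) ≤ 2 * |l * m⁻¹| ^ 3 := by
    rw [div_le_iff₀ (by linarith)]
    have : 0 ≤ |l * m⁻¹| ^ 3 := by positivity
    generalize |l * m⁻¹| = a at *
    norm_num
    nlinarith
  have h3 := h.trans h2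
  rw [Real.norm_eq_abs]
  calc |m ^ 2 * (Real.log (1 + l * m⁻¹) + 1 - (1 + l * m⁻¹)) - -(l ^ 2) / 2|
      = |m ^ 2 * (0 + (-(l * m⁻¹)) ^ (0 + 1) / (((0:ℕ):ℝ) + 1) +
          (-(l * m⁻¹)) ^ (1 + 1) / (((1:ℕ):ℝ) + 1) + Real.log (1 - -(l * m⁻¹)))| := by
        congr 1
        rw [sub_neg_eq_add]
        push_cast
        field_simp
        ring
    _ = m ^ 2 * _ := by rw [abs_mul, abs_of_pos (by positivity)]
    _ ≤ m ^ 2 * (2 * |l * m⁻¹| ^ 3) := by gcongr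
    _ = _ := by
        rw [abs_mul, abs_of_pos (inv_pos.2 hm)]
        field_simp

lemma ptwise (l x : ℝ) (hx : 0 < x) :
    Tendsto (fun m : ℝ => m ^ 3 * borelPMF ⌊x * m ^ 2⌋₊ (1 + l * m⁻¹)) atTop
      (nhds ((2 * π) ^ (-(1/2 : ℝ)) * x ^ (-(3/2 : ℝ)) * Real.exp (-(l ^ 2) * x / 2))) := by
  have hsq : Tendsto (fun m : ℝ => m ^ 2) atTop atTop := tendsto_pow_atTop (by norm_num)
  have hfl : Tendsto (fun m : ℝ => ⌊x * m ^ 2⌋₊) atTop atTop :=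
    tendsto_nat_floor_atTop.comp (hsq.const_mul_atTop hx)
  have hr : Tendsto (fun m : ℝ => (⌊x * m ^ 2⌋₊ : ℝ) / m ^ 2) atTop (nhds x) :=
    (tendsto_nat_floor_mul_div_atTop hx.le).comp hsq
  have hμ : Tendsto (fun m : ℝ => 1 + l * m⁻¹) atTop (nhds 1) := by
    simpa using (tendsto_inv_atTop_zero.const_mul l).const_add 1
  have hst := Stirling.tendsto_stirlingSeq_sqrt_pi.comp hfl
  have hri := hr.inv₀ hx.ne'
  have hmain := ((hμ.inv₀ one_ne_zero).mul (hri.mul hri.sqrt)).mul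
    ((hst.inv₀ (Real.sqrt_pos.2 Real.pi_pos).ne').const_mul (√2)⁻¹) |>.mul
      ((Real.continuous_exp.tendsto _).comp (hr.mul (log_lim l)))
  have hval : (2 * π) ^ (-(1/2 : ℝ)) * x ^ (-(3/2 : ℝ)) * Real.exp (-(l ^ 2) * x / 2) =
      (1:ℝ)⁻¹ * (x⁻¹ * √(x⁻¹)) * ((√2)⁻¹ * (√π)⁻¹) * Real.exp (x * (-(l ^ 2) / 2)) := by
    have e1 : (2 * π) ^ (-(1/2 : ℝ)) = (√2)⁻¹ * (√π)⁻¹ := by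
      rw [Real.rpow_neg (by positivity), ← Real.sqrt_eq_rpow, Real.sqrt_mul (by norm_num), mul_inv]
    have e2 : x ^ (-(3/2 : ℝ)) = x⁻¹ * √(x⁻¹) := by
      rw [show (-(3/2 : ℝ)) = -1 + -(1/2) by norm_num, Real.rpow_add hx, Real.rpow_neg_one,
        Real.rpow_neg hx.le, ← Real.sqrt_eq_rpow, Real.sqrt_inv]
    rw [e1, e2, show -(l ^ 2) * x / 2 = x * (-(l ^ 2) / 2) by ring]
    ring
  rw [hval]
  refine hmain.congr' ?_
  filter_upwards [eventually_gt_atTop 0, hfl.eventually_ge_atTop 1,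
    hμ.eventually_const_lt (show (0:ℝ) < 1 by norm_num)] with m hm hk hμp
  rw [borel_eq _ (by omega) _ hμp]
  have hk' : (0:ℝ) < (⌊x * m ^ 2⌋₊ : ℝ) := by exact_mod_cast hk
  simp only [Function.comp]
  rw [inv_div, Real.sqrt_div (by positivity), Real.sqrt_sq hm.le]
  rw [show (⌊x * m ^ 2⌋₊ : ℝ) / m ^ 2 * (m ^ 2 * (Real.log (1 + l * m⁻¹) + 1 - (1 + l * m⁻¹))) =
    (⌊x * m ^ 2⌋₊ : ℝ) * (Real.log (1 + l * m⁻¹) + 1 - (1 + l * m⁻¹)) by field_simp]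
  ring

lemma sum_lim (l ε : ℝ) (hε : 0 < ε) :
    Tendsto (fun m : ℝ => m * ∑' k : ℕ, if ε * m ^ 2 ≤ (k : ℝ) then
        borelPMF k (1 + l * m⁻¹) else 0) atTop
      (nhds (∫ x in Set.Ioi ε,
        (2 * π) ^ (-(1/2 : ℝ)) * x ^ (-(3/2 : ℝ)) * Real.exp (-(l ^ 2) * x / 2))) := by
  have hsq : Tendsto (fun m : ℝ => m ^ 2) atTop atTop := tendsto_pow_atTop (by norm_num)
  have hμ : Tendsto (fun m : ℝ => 1 + l * m⁻¹) atTop (nhds 1) := by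
    simpa using (tendsto_inv_atTop_zero.const_mul l).const_add 1
  have key : Tendsto (fun m : ℝ => ∫ x in Set.Ioi ε,
      m ^ 3 * (if ε * m ^ 2 ≤ ((⌊x * m ^ 2⌋₊ : ℕ) : ℝ) then
        borelPMF ⌊x * m ^ 2⌋₊ (1 + l * m⁻¹) else 0)) atTop
      (nhds (∫ x in Set.Ioi ε,
        (2 * π) ^ (-(1/2 : ℝ)) * x ^ (-(3/2 : ℝ)) * Real.exp (-(l ^ 2) * x / 2))) := by
    refine tendsto_integral_filter_of_dominated_convergence
      (fun x => 8 * x ^ (-(3/2) : ℝ)) ?_ ?_ ?_ ?_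
    · refine Eventually.of_forall fun m => ?_
      refine Measurable.aestronglyMeasurable ?_
      have h1 : Measurable (fun k : ℕ => m ^ 3 * (if ε * m ^ 2 ≤ (k : ℝ) then
        borelPMF k (1 + l * m⁻¹) else 0)) := Measurable.of_discrete
      have hm : Measurable (fun x : ℝ => ⌊x * m ^ 2⌋₊) := by fun_prop
      exact h1.comp hm
    · filter_upwards [eventually_gt_atTop 0, hsq.eventually_ge_atTop (2 / ε),
        hμ.eventually_const_lt (show (1/2:ℝ) < 1 by norm_num)] with m hm hm2 hμp
      refine (ae_restrict_mem measurableSet_Ioi).mono fun x hx => ?_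
      have hx : ε < x := hx
      have hx0 : 0 < x := hε.trans hx
      rw [div_le_iff₀ hε] at hm2
      have hxm : 2 ≤ x * m ^ 2 := by nlinarith [sq_nonneg m]
      have hk2 : x * m ^ 2 / 2 ≤ (⌊x * m ^ 2⌋₊ : ℝ) := by
        have := Nat.lt_floor_add_one (x * m ^ 2)
        linarith
      split_ifs with hc
      · have hk0 : (0:ℝ) < (⌊x * m ^ 2⌋₊ : ℝ) := by linarith
        have hkn : ⌊x * m ^ 2⌋₊ ≠ 0 := by
          intro h; rw [h] at hk0; simp at hk0
        rw [Real.norm_of_nonneg (mul_nonneg (by positivity) (borel_nonneg _ _ (by linarith)))]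
        have hsx : √(x * m ^ 2 / 2) = √x * m / √2 := by
          rw [Real.sqrt_div (by positivity), Real.sqrt_mul hx0.le, Real.sqrt_sq hm.le]
        have e2 : x ^ (-(3/2 : ℝ)) = x⁻¹ * (√x)⁻¹ := by
          rw [show (-(3/2 : ℝ)) = -1 + -(1/2) by norm_num, Real.rpow_add hx0, Real.rpow_neg_one,
            Real.rpow_neg hx0.le, ← Real.sqrt_eq_rpow]
        have hs2 : √2 ≤ 2 := by
          rw [Real.sqrt_le_left (by norm_num)]; norm_num
        calc _ ≤ m ^ 3 * (2 * (((⌊x * m ^ 2⌋₊ : ℕ) : ℝ)⁻¹ * (√((⌊x * m ^ 2⌋₊ : ℕ) : ℝ))⁻¹)) := by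
              gcongr
              exact borel_le _ hkn _ hμp.le
          _ ≤ m ^ 3 * (2 * ((x * m ^ 2 / 2)⁻¹ * (√(x * m ^ 2 / 2))⁻¹)) := by
              gcongr
          _ = 4 * √2 * (x⁻¹ * (√x)⁻¹) := by
              rw [hsx]
              have : 0 < √x := Real.sqrt_pos.2 hx0
              field_simp
              ring
          _ ≤ 4 * 2 * (x⁻¹ * (√x)⁻¹) := by gcongr
          _ = _ := by rw [e2]; ring
      · simp; positivity
    · exact (integrableOn_Ioi_rpow_of_lt (by norm_num) hε).const_mul 8
    · refine (ae_restrict_mem measurableSet_Ioi).mono fun x hx => ?_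
      have hx : ε < x := hx
      have hx0 : 0 < x := hε.trans hx
      refine (ptwise l x hx0).congr' ?_
      have hr : Tendsto (fun m : ℝ => (⌊x * m ^ 2⌋₊ : ℝ) / m ^ 2) atTop (nhds x) :=
        (tendsto_nat_floor_mul_div_atTop hx0.le).comp hsq
      filter_upwards [eventually_gt_atTop 0, hr.eventually_const_lt hx] with m hm h
      rw [if_pos]
      rw [lt_div_iff₀ (by positivity)] at h
      exact h.le
  refine key.congr' ?_
  filter_upwards [eventually_gt_atTop 0] with m hm
  have hm2 : 0 < m ^ 2 := by positivity
  rw [tsum_eq_int (m ^ 2) hm2, integral_const_mul, ← integral_Ici_eq_integral_Ioi,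
    setIntegral_eq_of_subset_of_forall_sdiff_eq_zero (s := Set.Ici ε) measurableSet_Ici
      (Set.Ici_subset_Ici.2 hε.le)]
  · ring
  · rintro x ⟨h1, h2⟩
    simp only [Set.mem_Ici, not_le] at h1 h2
    rw [if_neg]
    rw [not_le]
    calc _ ≤ x * m ^ 2 := Nat.floor_le (by positivity)
      _ < _ := by gcongr

theorem stmt_7 (l ε : ℝ) (hε : 0 < ε) (q : ℝ → ℝ)
    (hq0 : ∀ μ : ℝ, μ ≤ 1 → q μ = 0)
    (hq1 : ∀ μ : ℝ, 1 < μ → q μ ∈ Set.Ioo (0 : ℝ) 1 ∧ 1 - q μ = Real.exp (-μ * q μ)) :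
    Tendsto
      (fun n : ℕ => (n : ℝ) ^ ((1:ℝ)/3) *
        (q (1 + l * (n : ℝ) ^ (-(1:ℝ)/3)) +
          ∑' k : ℕ, if ε * (n : ℝ) ^ ((2:ℝ)/3) ≤ (k : ℝ) then
            borelPMF k (1 + l * (n : ℝ) ^ (-(1:ℝ)/3)) else 0))
      atTop
      (nhds (2 * max l 0 + ∫ x in Set.Ioi ε,
        (2 * π) ^ (-(1/2 : ℝ)) * x ^ (-(3/2 : ℝ)) * Real.exp (-(l ^ 2) * x / 2))) := by
  have hm : Tendsto (fun n : ℕ => (n : ℝ) ^ ((1:ℝ)/3)) atTop atTop :=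
    (tendsto_rpow_atTop (by norm_num)).comp tendsto_natCast_atTop_atTop
  refine (((q_lim l q hq0 hq1).add (sum_lim l ε hε)).comp hm).congr fun n => ?_
  have e1 : (n : ℝ) ^ (-(1:ℝ)/3) = ((n : ℝ) ^ ((1:ℝ)/3))⁻¹ := by
    rw [neg_div, Real.rpow_neg (by positivity)]
  have e2 : (n : ℝ) ^ ((2:ℝ)/3) = ((n : ℝ) ^ ((1:ℝ)/3)) ^ 2 := by
    rw [← Real.rpow_natCast, ← Real.rpow_mul (by positivity)]
    norm_num
  simp only [Function.comp, e1, e2]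
  ring
end

section
/- With φ_λ(x) := (λ/(4π))^{1/2} e^{-λ(x−2λ)²/4}, one has ∫_λ^∞ | (8π)^{-1/2} x^{1/2} e^{-x(x−2λ)²/8} − φ_λ(x) | dx → 0 as λ → +∞. -/
open Real MeasureTheory Filter

noncomputable def auxF (l x : ℝ) : ℝ :=
  |(8 * π) ^ (-(1/2 : ℝ)) * Real.sqrt x * Real.exp (-x * (x - 2 * l) ^ 2 / 8) -
          (l / (4 * π)) ^ ((1/2 : ℝ)) * Real.exp (-l * (x - 2 * l) ^ 2 / 4)|

noncomputable def auxK (w t : ℝ) : ℝ :=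
  |(Real.sqrt (8 * π))⁻¹ * Real.sqrt (2 + w) * Real.exp (-(2 + w) * t ^ 2 / 8) -
          (Real.sqrt (4 * π))⁻¹ * Real.exp (-t ^ 2 / 4)|

noncomputable def auxH (l t : ℝ) : ℝ :=
  (Real.sqrt l)⁻¹ * (Set.Ioi l).indicator (auxF l) (2 * l + (Real.sqrt l)⁻¹ * t)

lemma aux_subst (l : ℝ) (hl : 0 < l) : ∫ x in Set.Ioi l, auxF l x = ∫ t, auxH l t := by
  have hs : 0 < Real.sqrt l := Real.sqrt_pos.2 hl
  unfold auxH
  rw [integral_const_mul, Measure.integral_comp_mul_left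
    (fun y => (Set.Ioi l).indicator (auxF l) (2 * l + y)),
    integral_add_left_eq_self (fun y => (Set.Ioi l).indicator (auxF l) y),
    integral_indicator measurableSet_Ioi, inv_inv, abs_of_pos hs, smul_eq_mul,
    ← mul_assoc, inv_mul_cancel₀ hs.ne', one_mul]

lemma aux_FK (l t : ℝ) (hl : 0 < l) :
    (Real.sqrt l)⁻¹ * auxF l (2 * l + (Real.sqrt l)⁻¹ * t) = auxK (t / (l * Real.sqrt l)) t := by
  obtain ⟨s, hs, rfl⟩ : ∃ s : ℝ, 0 < s ∧ l = s ^ 2 :=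
    ⟨Real.sqrt l, Real.sqrt_pos.2 hl, (Real.sq_sqrt hl.le).symm⟩
  have hpi := Real.pi_pos
  unfold auxF auxK
  rw [Real.rpow_neg (by positivity), ← Real.sqrt_eq_rpow, ← Real.sqrt_eq_rpow,
    Real.sqrt_div' _ (by positivity), Real.sqrt_sq hs.le]
  have h1 : 2 * s ^ 2 + s⁻¹ * t = s ^ 2 * (2 + t / (s ^ 2 * s)) := by field_simp
  have h2 : 2 * s ^ 2 + s⁻¹ * t - 2 * s ^ 2 = s⁻¹ * t := by ring
  rw [h2, h1, Real.sqrt_mul (x := s ^ 2) (by positivity), Real.sqrt_sq hs.le]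
  nth_rewrite 1 [← abs_of_pos (inv_pos.2 hs)]
  rw [← abs_mul]
  congr 1
  have h3 : -(s ^ 2 * (2 + t / (s ^ 2 * s))) * (s⁻¹ * t) ^ 2 / 8
      = -(2 + t / (s ^ 2 * s)) * t ^ 2 / 8 := by field_simp
  have h4 : -s ^ 2 * (s⁻¹ * t) ^ 2 / 4 = -t ^ 2 / 4 := by field_simp
  rw [h3, h4]
  generalize rexp _ = a
  generalize rexp _ = b
  generalize √(2 + _) = c
  have : 0 < √(4 * π) := by positivity
  have : 0 < √(8 * π) := by positivity
  field_simp

lemma aux_HK (l t : ℝ) (hl : 0 < l) : |auxH l t| ≤ auxK (t / (l * Real.sqrt l)) t := by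
  have hs : 0 < Real.sqrt l := Real.sqrt_pos.2 hl
  have hF : ∀ x, 0 ≤ auxF l x := fun x => abs_nonneg _
  rw [← aux_FK l t hl]
  unfold auxH
  rw [abs_of_nonneg (mul_nonneg (by positivity) (Set.indicator_nonneg (fun x _ => hF x) _))]
  gcongr
  exact Set.indicator_le_self' (fun x _ => hF x) _

lemma aux_K_bound (w t : ℝ) (h1 : -1 ≤ w) (h2 : w ≤ |t|) :
    auxK w t ≤ (2 + |t|) * rexp (-(1/8) * t ^ 2) + rexp (-(1/4) * t ^ 2) := by
  have hpi := Real.pi_gt_three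
  have a1 : (√(8 * π))⁻¹ ≤ 1 := inv_le_one_of_one_le₀ (Real.one_le_sqrt.2 (by linarith))
  have a2 : (√(4 * π))⁻¹ ≤ 1 := inv_le_one_of_one_le₀ (Real.one_le_sqrt.2 (by linarith))
  have a3 : √(2 + w) ≤ 2 + |t| := by
    rw [Real.sqrt_le_iff]
    have := abs_nonneg t
    constructor <;> nlinarith
  have e1 : rexp (-(2 + w) * t ^ 2 / 8) ≤ rexp (-(1/8) * t ^ 2) := by
    apply Real.exp_le_exp.2
    nlinarith [sq_nonneg t]
  have e2 : rexp (-t ^ 2 / 4) = rexp (-(1/4) * t ^ 2) := by congr 1; ring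
  unfold auxK
  refine (abs_sub _ _).trans ?_
  rw [e2, abs_of_nonneg (by positivity), abs_of_nonneg (by positivity)]
  have b1 : (√(8 * π))⁻¹ * √(2 + w) ≤ 1 * (2 + |t|) := by gcongr
  have b2 := mul_le_mul b1 e1 (Real.exp_pos _).le (by positivity)
  have b3 := mul_le_mul_of_nonneg_right a2 (Real.exp_pos (-(1/4) * t ^ 2)).le
  linarith

lemma aux_H_bound (l t : ℝ) (hl : 1 ≤ l) :
    ‖auxH l t‖ ≤ (2 + |t|) * rexp (-(1/8) * t ^ 2) + rexp (-(1/4) * t ^ 2) := by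
  have hl0 : 0 < l := by linarith
  have hs : 1 ≤ Real.sqrt l := Real.one_le_sqrt.2 hl
  have hs0 : 0 < Real.sqrt l := by linarith
  by_cases h : l < 2 * l + (Real.sqrt l)⁻¹ * t
  · refine (aux_HK l t hl0).trans (aux_K_bound _ _ ?_ ?_)
    · rw [le_div_iff₀ (by positivity)]
      have : 0 < (l + (√l)⁻¹ * t) * √l := mul_pos (by linarith) hs0
      have e : (l + (√l)⁻¹ * t) * √l = l * √l + t := by field_simp
      linarith
    · rw [div_le_iff₀ (by positivity)]
      have : 1 ≤ l * √l := by nlinarith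
      nlinarith [abs_nonneg t, le_abs_self t]
  · unfold auxH
    rw [Set.indicator_of_notMem (by simpa using h)]
    simp only [mul_zero, norm_zero]
    positivity

lemma aux_int : Integrable
    (fun t : ℝ => (2 + |t|) * rexp (-(1/8) * t ^ 2) + rexp (-(1/4) * t ^ 2)) := by
  have i1 := integrable_exp_neg_mul_sq (b := 1/8) (by norm_num)
  have i2 := integrable_exp_neg_mul_sq (b := 1/4) (by norm_num)
  have i3 := (integrable_mul_exp_neg_mul_sq (b := 1/8) (by norm_num)).abs
  refine (((i1.const_mul 2).add i3).add i2).congr (Eventually.of_forall fun t => ?_)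
  simp only [Pi.add_apply, abs_mul, Real.abs_exp]
  ring

lemma aux_lim (t : ℝ) : Tendsto (fun l => auxH l t) atTop (nhds 0) := by
  have hw : Tendsto (fun l : ℝ => t / (l * √l)) atTop (nhds 0) :=
    tendsto_const_nhds.div_atTop (tendsto_id.atTop_mul_atTop₀ Real.tendsto_sqrt_atTop)
  have hc : Continuous (fun w => auxK w t) := by unfold auxK; fun_prop
  have h0 : auxK 0 t = 0 := by
    unfold auxK
    have e : -(2 + 0) * t ^ 2 / 8 = -t ^ 2 / 4 := by ring
    have : (8 * π) = 4 * π * 2 := by ring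
    have h2 : 0 < √2 := by positivity
    have hp : 0 < √(4 * π) := by positivity
    rw [e, this, Real.sqrt_mul (by positivity), add_zero, abs_eq_zero]
    field_simp
    ring
  have hk := (hc.tendsto 0).comp hw
  rw [h0] at hk
  refine squeeze_zero_norm' ?_ hk
  filter_upwards [eventually_gt_atTop 0] with l hl
  exact aux_HK l t hl

theorem stmt_17 :
    Tendsto
      (fun l : ℝ => ∫ x in Set.Ioi l,
        |(8 * π) ^ (-(1/2 : ℝ)) * Real.sqrt x * Real.exp (-x * (x - 2 * l) ^ 2 / 8) -
          (l / (4 * π)) ^ ((1/2 : ℝ)) * Real.exp (-l * (x - 2 * l) ^ 2 / 4)|)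
      atTop (nhds 0) := by
  have key : Tendsto (fun l => ∫ t, auxH l t) atTop (nhds (∫ _ : ℝ, (0:ℝ))) := by
    refine tendsto_integral_filter_of_dominated_convergence _ ?_ ?_ aux_int
      (Eventually.of_forall aux_lim)
    · refine Eventually.of_forall fun l => Measurable.aestronglyMeasurable ?_
      have hF : Measurable (auxF l) := by unfold auxF; fun_prop
      unfold auxH
      exact ((hF.indicator measurableSet_Ioi).comp (by fun_prop)).const_mul _
    · filter_upwards [eventually_ge_atTop 1] with l hl
      exact Eventually.of_forall fun t => aux_H_bound l t hl
  rw [integral_zero] at key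
  refine key.congr' ?_
  filter_upwards [eventually_gt_atTop 0] with l hl
  exact (aux_subst l hl).symm
end
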